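/- The Gray graph is not vertex-transitive: there exist vertices u and v of the Gray graph such that no graph automorphism of the Gray graph maps u to v. -/

import Mathlib

def lcfD (x : ZMod 6) : ℤ :=
  if x = 0 then 7 else if x = 1 then -7 else if x = 2 then 13
  else if x = 3 then -13 else if x = 4 then 25 else -25

def grayGraph : SimpleGraph (ZMod 54) :=
  SimpleGraph.fromRel (fun u v => v = u + 1 ∨ v = u + ((lcfD ((u.val : ZMod 6))) : ZMod 54))

namespace SimpleGraph

variable {V W : Type*} [Fintype V] [Fintype W] (G : SimpleGraph V) (H : SimpleGraph W)
  [DecidableRel G.Adj] [DecidableRel H.Adj]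

/-- The vertices adjacent to some vertex of `s`. -/
def adjacentFinset (s : Finset V) : Finset V := {x | ∃ y ∈ s, G.Adj y x}

variable {G H}

theorem Iso.adjacentFinset_map (φ : G ≃g H) (s : Finset V) :
    H.adjacentFinset (s.map φ.toEquiv.toEmbedding) =
      (G.adjacentFinset s).map φ.toEquiv.toEmbedding := by
  ext x
  obtain ⟨x, rfl⟩ := φ.surjective x
  have mem_map (t : Finset V) (y : V) : φ y ∈ t.map φ.toEquiv.toEmbedding ↔ y ∈ t :=
    Finset.mem_map' _
  simp [adjacentFinset, mem_map, φ.surjective.exists, φ.map_adj_iff, -Finset.mem_map_equiv]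

theorem Iso.iterate_adjacentFinset_map (φ : G ≃g H) (n : ℕ) (s : Finset V) :
    H.adjacentFinset^[n] (s.map φ.toEquiv.toEmbedding) =
      (G.adjacentFinset^[n] s).map φ.toEquiv.toEmbedding :=
  (Function.Semiconj.iterate_right (fun s => (φ.adjacentFinset_map s).symm) n s).symm

/-- Isomorphisms preserve the number of vertices reached by walks of length `n`. -/
theorem Iso.card_iterate_adjacentFinset (φ : G ≃g H) (n : ℕ) (v : V) :
    (H.adjacentFinset^[n] {φ v}).card = (G.adjacentFinset^[n] {v}).card := by
  rw [← Finset.card_map φ.toEquiv.toEmbedding, ← φ.iterate_adjacentFinset_map n]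
  simp

end SimpleGraph

instance : DecidableRel grayGraph.Adj := fun u v =>
  decidable_of_iff _ (SimpleGraph.fromRel_adj _ u v).symm

/-- Walks of length four reach 23 vertices from `0` but only 19 from `1`. -/
theorem grayGraph_card_adjacentFinset_ne :
    (grayGraph.adjacentFinset^[4] {1}).card ≠ (grayGraph.adjacentFinset^[4] {0}).card := by
  decide +kernel

theorem gray_graph_not_vertex_transitive :
    ∃ u v : ZMod 54, ∀ φ : grayGraph ≃g grayGraph, φ u ≠ v := by
  refine ⟨0, 1, fun φ h => grayGraph_card_adjacentFinset_ne ?_⟩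
  rw [← h, φ.card_iterate_adjacentFinset]
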